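/- Fix an integer m ≥ 2. For every integer k ≥ 2 and every i ∈ {0,1,…,m−1}, r_ℳ(i,m,k) = Σ_{l=0,…,m−1, gcd(l,m) ∣ gcd(i,m)} r_ℳ(l,m,k−1)·gcd(l,m), where gcd(0,m) is understood as m. Moreover r_ℳ(1,m,1) = m and r_ℳ(i,m,1) = 0 for i ≠ 1. -/

import Mathlib

/-- `pM m k n` is the number of restricted `m`-ary partitions of `n` with parts
`1, m, m^2, …, m^(k-1)`. -/
noncomputable def pM (m k n : ℕ) : ℕ :=
  Nat.card {x : Fin k → ℕ // ∑ i : Fin k, x i * m ^ (i : ℕ) = n}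

/-- `rM i m k = #{n ∈ {0,…,m^k - 1} : p_ℳ(n,k) ≡ i (mod m)}`. -/
noncomputable def rM (i m k : ℕ) : ℕ :=
  ((Finset.range (m ^ k)).filter (fun n : ℕ => pM m k n % m = i)).card

lemma sum_range_mul_eq_sum_sum {m : ℕ} (hm : 0 < m) (f : ℕ → ℕ → ℕ) (q : ℕ) :
    ∑ n ∈ Finset.range (m * q), f (n / m) (n % m) =
      ∑ a ∈ Finset.range q, ∑ b ∈ Finset.range m, f a b := by
  induction q with
  | zero => simp
  | succ q ih =>
    rw [Nat.mul_succ, Finset.sum_range_add, ih, Finset.sum_range_succ]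
    congr 1
    refine Finset.sum_congr rfl fun b hb => ?_
    have hb := Finset.mem_range.1 hb
    rw [Nat.mul_add_div hm, Nat.mul_add_mod, Nat.div_eq_of_lt hb, Nat.mod_eq_of_lt hb, add_zero]

lemma finite_partitions {m : ℕ} (hm : 0 < m) (k n : ℕ) :
    Finite {x : Fin k → ℕ // ∑ i : Fin k, x i * m ^ (i : ℕ) = n} := by
  refine Set.Finite.subset (Set.finite_Iic (fun _ : Fin k => n)) fun x hx i => ?_
  have hx : ∑ i : Fin k, x i * m ^ (i : ℕ) = n := hx
  calc x i ≤ x i * m ^ (i : ℕ) := Nat.le_mul_of_pos_right _ (by positivity)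
    _ ≤ ∑ i : Fin k, x i * m ^ (i : ℕ) :=
      Finset.single_le_sum (f := fun i : Fin k => x i * m ^ (i : ℕ)) (by simp) (Finset.mem_univ i)
    _ = n := hx

lemma sum_mul_pow_succ (m k : ℕ) (x : Fin (k + 1) → ℕ) :
    ∑ i : Fin (k + 1), x i * m ^ (i : ℕ) = x 0 + m * ∑ i : Fin k, x i.succ * m ^ (i : ℕ) := by
  rw [Fin.sum_univ_succ, Finset.mul_sum]
  simp only [Fin.val_zero, pow_zero, mul_one, Fin.val_succ, pow_succ]
  congr 1
  exact Finset.sum_congr rfl fun i _ => by ring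

lemma pM_succ {m : ℕ} (hm : 0 < m) (k n : ℕ) :
    pM m (k + 1) n = ∑ j ∈ Finset.range (n / m + 1), pM m k j := by
  have := finite_partitions hm k
  rw [← Fin.sum_univ_eq_sum_range]
  unfold pM
  rw [← Nat.card_sigma]
  symm
  let F : (Σ j : Fin (n / m + 1), {y : Fin k → ℕ // ∑ i : Fin k, y i * m ^ (i : ℕ) = j}) →
      {x : Fin (k + 1) → ℕ // ∑ i : Fin (k + 1), x i * m ^ (i : ℕ) = n} := fun p =>
    ⟨Fin.cons (n - m * p.1) p.2.1, by
      have h : m * p.1 ≤ n :=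
        (Nat.mul_le_mul_left m (Nat.lt_succ_iff.1 p.1.2)).trans (Nat.mul_div_le n m)
      rw [sum_mul_pow_succ]
      simp only [Fin.cons_zero, Fin.cons_succ, p.2.2]
      omega⟩
  refine Nat.card_congr (Equiv.ofBijective F ⟨?_, ?_⟩)
  · rintro ⟨j, y, hy⟩ ⟨j', y', hy'⟩ h
    obtain rfl : y = y' := by
      simpa [F] using congrArg (fun x => Fin.tail x.1) h
    obtain rfl : j = j' := Fin.ext (hy.symm.trans hy')
    rfl
  · rintro ⟨x, hx⟩
    have hx' := hx
    rw [sum_mul_pow_succ] at hx'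
    refine ⟨⟨⟨∑ i : Fin k, x i.succ * m ^ (i : ℕ), ?_⟩, fun i => x i.succ, rfl⟩, ?_⟩
    · rw [Nat.lt_succ_iff, Nat.le_div_iff_mul_le hm, mul_comm]
      omega
    · refine Subtype.ext (funext fun i => ?_)
      refine Fin.cases ?_ (fun i => ?_) i
      · simp only [F, Fin.cons_zero]
        omega
      · simp only [F, Fin.cons_succ]

lemma pM_zero_zero (m : ℕ) : pM m 0 0 = 1 := by
  simp [pM]

lemma pM_zero_of_ne {m n : ℕ} (hn : n ≠ 0) : pM m 0 n = 0 := by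
  simp [pM, hn.symm]

lemma pM_one {m : ℕ} (hm : 0 < m) (n : ℕ) : pM m 1 n = 1 := by
  rw [pM_succ hm, Finset.sum_eq_single 0 (fun j _ hj => pM_zero_of_ne hj) (by simp), pM_zero_zero]

lemma pM_succ_eq_pM_mul_div {m : ℕ} (hm : 0 < m) (k n : ℕ) :
    pM m (k + 1) n = pM m (k + 1) (m * (n / m)) := by
  rw [pM_succ hm, pM_succ hm, Nat.mul_div_cancel_left _ hm]

lemma pM_add_two_modEq {m : ℕ} (hm : 0 < m) (k n : ℕ) :
    pM m (k + 2) n ≡ (n / m % m + 1) * pM m (k + 1) (m * (n / m / m)) [MOD m] := by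
  have hr : n / m % m < m := Nat.mod_lt _ hm
  set g : ℕ → ℕ := fun q => pM m (k + 1) (m * q)
  have h : pM m (k + 2) n = ∑ j ∈ Finset.range (n / m + 1), g (j / m) := by
    rw [pM_succ hm]
    exact Finset.sum_congr rfl fun j _ => pM_succ_eq_pM_mul_div hm k j
  have htail : ∑ b ∈ Finset.range (n / m % m + 1), g ((m * (n / m / m) + b) / m) =
      (n / m % m + 1) * g (n / m / m) := by
    rw [Finset.sum_congr rfl (g := fun _ => g (n / m / m)), Finset.sum_const, Finset.card_range,
      smul_eq_mul]
    intro b hb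
    have hb := Finset.mem_range.1 hb
    rw [Nat.mul_add_div hm, Nat.div_eq_of_lt (by omega : b < m), add_zero]
  have hsplit : n / m + 1 = m * (n / m / m) + (n / m % m + 1) := by
    rw [← add_assoc, Nat.div_add_mod]
  rw [h, congrArg Finset.range hsplit, Finset.sum_range_add, htail, sum_range_mul_eq_sum_sum hm (fun a _ => g a)]
  simp only [Finset.sum_const, Finset.card_range, smul_eq_mul, ← Finset.mul_sum]
  exact Nat.mul_add_mod _ _ _

lemma card_modEq_Ioc {d r : ℕ} (hr : 0 < r) (v : ℕ) :
    ((Finset.Ioc 0 (d * r)).filter (fun c => c ≡ v [MOD r])).card = d := by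
  have h := Nat.Ioc_filter_modEq_card 0 (d * r) hr v
  have hr' : (r : ℚ) ≠ 0 := by positivity
  have e : (((d * r : ℕ) : ℚ) - v) / r = ((0 : ℕ) - v) / r + (d : ℤ) := by
    push_cast
    field_simp
    ring
  rw [e, Int.floor_add_intCast] at h
  simpa using h

lemma card_mul_mod_eq {m : ℕ} (hm : 0 < m) (l : ℕ) {i : ℕ} (hi : i < m) :
    ((Finset.range m).filter (fun a => (a + 1) * l % m = i)).card =
      if Nat.gcd l m ∣ Nat.gcd i m then Nat.gcd l m else 0 := by
  have hshift : ((Finset.range m).filter (fun a => (a + 1) * l % m = i)).card =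
      ((Finset.Ioc 0 m).filter (fun c => c * l ≡ i [MOD m])).card := by
    refine Finset.card_bij (fun a _ => a + 1) ?_ (by simp) ?_
    · simp only [Finset.mem_filter, Finset.mem_range, Finset.mem_Ioc]
      rintro a ⟨ha, h⟩
      exact ⟨by omega, h.trans (Nat.mod_eq_of_lt hi).symm⟩
    · simp only [Finset.mem_filter, Finset.mem_range, Finset.mem_Ioc]
      rintro c ⟨hc, h⟩
      replace h : c * l % m = i := Eq.trans h (Nat.mod_eq_of_lt hi)
      exact ⟨c - 1, ⟨by omega, by rwa [Nat.sub_add_cancel hc.1]⟩, Nat.sub_add_cancel hc.1⟩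
  rw [hshift]
  have hd : 0 < Nat.gcd l m := Nat.gcd_pos_of_pos_right l hm
  obtain ⟨l', m', hcop, hl, hm'⟩ := Nat.exists_coprime l m
  generalize Nat.gcd l m = d at *
  subst hl hm'
  have hm'pos : 0 < m' := Nat.pos_of_mul_pos_right hm
  split_ifs with h
  · obtain ⟨i', rfl⟩ := h.trans (Nat.gcd_dvd_left _ _)
    obtain ⟨u, -, hu⟩ := Nat.exists_mul_mod_eq_of_coprime i' hcop hm'pos.ne'
    rw [mul_comm m' d]
    convert card_modEq_Ioc (d := d) hm'pos u using 3 with c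
    rw [show c * (l' * d) = d * (l' * c) by ring, Nat.ModEq.mul_left_cancel_iff' hd.ne']
    replace hu : l' * u ≡ i' [MOD m'] := hu
    exact ⟨fun hc => Nat.ModEq.cancel_left_of_coprime hcop.symm (hc.trans hu.symm),
      fun hc => (hc.mul_left l').trans hu⟩
  · rw [Finset.card_eq_zero, Finset.filter_eq_empty_iff]
    intro c _ hc
    refine h (Nat.dvd_gcd ?_ (dvd_mul_left _ _))
    exact (hc.dvd_iff (dvd_mul_left d m')).1 ((dvd_mul_left d l').mul_left c)

lemma rM_succ {m : ℕ} (hm : 0 < m) (i k : ℕ) :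
    rM i m (k + 1) =
      m * ((Finset.range (m ^ k)).filter (fun q => pM m (k + 1) (m * q) % m = i)).card := by
  unfold rM
  rw [Finset.card_filter, Finset.card_filter, pow_succ', Finset.mul_sum]
  have := sum_range_mul_eq_sum_sum hm
    (fun a _ => if pM m (k + 1) (m * a) % m = i then 1 else 0) (m ^ k)
  simp only [Finset.sum_const, Finset.card_range, smul_eq_mul] at this
  rw [← this]
  exact Finset.sum_congr rfl fun n _ => by rw [pM_succ_eq_pM_mul_div hm]

lemma rM_add_two {m : ℕ} (hm : 0 < m) {i : ℕ} (hi : i < m) (k : ℕ) :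
    rM i m (k + 2) = ∑ l ∈ (Finset.range m).filter (fun l => Nat.gcd l m ∣ Nat.gcd i m),
      rM l m (k + 1) * Nat.gcd l m := by
  set g : ℕ → ℕ := fun q => pM m (k + 1) (m * q) % m with hg
  have hpM (n : ℕ) : pM m (k + 2) (m * n) % m = (n % m + 1) * g (n / m) % m := by
    have := pM_add_two_modEq hm k (m * n)
    rw [Nat.mul_div_cancel_left _ hm] at this
    exact this.trans ((Nat.mod_modEq _ _).symm.mul_left _)
  set N : ℕ → ℕ := fun l => if Nat.gcd l m ∣ Nat.gcd i m then Nat.gcd l m else 0 with hN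
  have hcount : ((Finset.range (m ^ (k + 1))).filter
      (fun n => pM m (k + 2) (m * n) % m = i)).card = ∑ q ∈ Finset.range (m ^ k), N (g q) := by
    simp only [hpM]
    rw [Finset.card_filter, pow_succ', sum_range_mul_eq_sum_sum hm
      (fun a b => if (b + 1) * g a % m = i then 1 else 0)]
    exact Finset.sum_congr rfl fun q _ => by
      rw [← Finset.card_filter, card_mul_mod_eq hm _ hi]
  rw [rM_succ hm, hcount, Finset.sum_filter,
    ← Finset.sum_fiberwise_of_maps_to (t := Finset.range m) (g := g)
      (fun q _ => Finset.mem_range.2 (Nat.mod_lt _ hm)), Finset.mul_sum]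
  refine Finset.sum_congr rfl fun l _ => ?_
  rw [Finset.sum_congr rfl (g := fun _ => N l) (fun q hq => by rw [(Finset.mem_filter.1 hq).2]),
    Finset.sum_const, smul_eq_mul, rM_succ hm, ← mul_assoc, hN]
  simp only [mul_ite, mul_zero, hg]

theorem stmt_12 (m : ℕ) (hm : 2 ≤ m) :
    (∀ k, 2 ≤ k → ∀ i < m,
      rM i m k = ∑ l ∈ (Finset.range m).filter (fun l => Nat.gcd l m ∣ Nat.gcd i m),
        rM l m (k - 1) * Nat.gcd l m) ∧
    rM 1 m 1 = m ∧ (∀ i < m, i ≠ 1 → rM i m 1 = 0) := by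
  have hm0 : 0 < m := by omega
  have h1 : 1 % m = 1 := Nat.mod_eq_of_lt hm
  refine ⟨fun k hk i hi => ?_, ?_, fun i _ hi => ?_⟩
  · obtain ⟨k, rfl⟩ := Nat.exists_eq_add_of_le' hk
    exact rM_add_two hm0 hi k
  · simp [rM, pM_one hm0, h1]
  · simp [rM, pM_one hm0, h1, hi.symm]
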